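/- Let L be a free abelian group of rank 2n with an action of the dihedral group D = ⟨t,u⟩ of order 8 whose central involution acts as -1, let f = tu (order 4), and let d be the number of Jordan blocks of size 2 for u on L/Tel(t). Then the index |L(t-1)+L(u-1) : L(f-1)| = 2^d. In particular, L(f-1) = L(t-1) + L(u-1) (commutator density) if and only if d = 0, i.e., if and only if L = L^+(t) + L^-(t) + L^+(u) ... equivalently L = Tel(t) + L^+(u) (2/4-generation). -/

import Mathlib

/-- The `+1`-eigenlattice of an involution `t` on `L`. -/
def eigP {L : Type*} [AddCommGroup L] (t : Module.End ℤ L) : Submodule ℤ L :=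
  LinearMap.ker (t - 1)

/-- The `-1`-eigenlattice of an involution `t` on `L`. -/
def eigM {L : Type*} [AddCommGroup L] (t : Module.End ℤ L) : Submodule ℤ L :=
  LinearMap.ker (t + 1)

/-- The total eigenlattice `Tel(t) = L^+(t) + L^-(t)`. -/
def Tel {L : Type*} [AddCommGroup L] (t : Module.End ℤ L) : Submodule ℤ L :=
  eigP t ⊔ eigM t


section DihedralAction

variable {L : Type*} [AddCommGroup L] {t u : Module.End ℤ L}

theorem involution_apply_apply (ht : t * t = 1) (x : L) : t (t x) = x := by
  simpa using LinearMap.congr_fun ht x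

theorem anticomm_apply (ht : t * t = 1) (hu : u * u = 1) (hz : (t * u) * (t * u) = -1) (x : L) :
    u (t x) = -t (u x) := by
  have h : t (u (t (u (u x)))) = -u x := by simpa using LinearMap.congr_fun hz (u x)
  rw [involution_apply_apply hu] at h
  rw [← involution_apply_apply ht (u (t x)), h, map_neg]

theorem mem_eigP {x : L} : x ∈ eigP t ↔ t x = x := by
  simp [eigP, sub_eq_zero]

theorem mem_eigM {x : L} : x ∈ eigM t ↔ t x = -x := by
  simp [eigM, add_eq_zero_iff_eq_neg]

theorem range_mul_sub_one_le : LinearMap.range (t * u - 1) ≤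
    LinearMap.range (t - 1) ⊔ LinearMap.range (u - 1) := by
  rintro _ ⟨x, rfl⟩
  refine Submodule.mem_sup.mpr ⟨_, ⟨u x, rfl⟩, _, ⟨x, rfl⟩, ?_⟩
  simp

variable [Module.Free ℤ L]

theorem eq_zero_of_add_self {x : L} (h : x + x = 0) : x = 0 := by
  have h2 : (2 : ℤ) • x = 0 := by rw [two_smul, h]
  simpa using h2

theorem mem_Tel_iff (ht : t * t = 1) {z : L} : z ∈ Tel t ↔ ∃ y, t z - z = y + y := by
  have htt := involution_apply_apply ht
  constructor
  · intro h
    obtain ⟨a, ha, b, hb, rfl⟩ := Submodule.mem_sup.mp h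
    rw [mem_eigP] at ha
    rw [mem_eigM] at hb
    exact ⟨-b, by rw [map_add, ha, hb]; abel⟩
  · rintro ⟨y, hy⟩
    have hz : t z = z + (y + y) := by rw [← hy]; abel
    have hty : t y = -y := by
      have h := htt z
      rw [hz, map_add, hz, map_add] at h
      rw [← add_eq_zero_iff_eq_neg]
      apply eq_zero_of_add_self
      rw [← sub_eq_zero] at h
      rw [← h]
      abel
    have h1 : z + y ∈ eigP t := by
      rw [mem_eigP, map_add, hz, hty]
      abel
    have h2 : -y ∈ eigM t := by
      rw [mem_eigM, map_neg, hty]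
    rw [← add_neg_cancel_right z y]
    exact Submodule.add_mem_sup h1 h2

theorem sub_mem_range_iff_sub_mem_Tel (ht : t * t = 1) (hu : u * u = 1)
    (hz : (t * u) * (t * u) = -1) (x : L) :
    t x - x ∈ LinearMap.range (t * u - 1) ↔ u x - x ∈ Tel t := by
  have htt := involution_apply_apply ht
  have huu := involution_apply_apply hu
  have hut := anticomm_apply ht hu hz
  rw [mem_Tel_iff ht]
  constructor
  · rintro ⟨y, hy⟩
    replace hy : t (u y) - y = t x - x := by simpa using hy
    have h := congrArg (fun v => t (u v) - v) hy
    simp only [map_sub, hut, huu, htt, map_neg] at h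
    refine ⟨t (u x) - t (u y), ?_⟩
    simp only [map_sub]
    rw [← sub_eq_zero] at h ⊢
    rw [← neg_eq_zero, ← h]
    abel
  · rintro ⟨y, hy⟩
    simp only [map_sub] at hy
    obtain ⟨w, rfl⟩ : ∃ w, y = w + t (u x) := ⟨y - t (u x), by abel⟩
    refine ⟨t (u w), ?_⟩
    have hw : (t * u - 1) (t (u w)) = -w - t (u w) := by
      simp [hut, huu, htt]
    suffices t (u w) = x - t x - w by
      rw [hw, this]
      abel
    have h1 : u x + t x = x - t (u x) - (w + w) := by
      rw [← sub_eq_zero] at hy ⊢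
      rw [← neg_eq_zero, ← hy]
      abel
    have h2 := congrArg (fun v => t (u v)) h1
    simp only [map_add, map_sub, hut, huu, htt, map_neg] at h2
    rw [← sub_eq_zero]
    apply eq_zero_of_add_self
    rw [← sub_eq_zero] at h1 h2
    rw [← add_zero (0 : L)]
    nth_rewrite 1 [← h1]
    rw [← h2]
    abel

theorem card_commutator_quotient_eq (ht : t * t = 1) (hu : u * u = 1)
    (hz : (t * u) * (t * u) = -1) :
    Nat.card ((LinearMap.range (t - 1) ⊔ LinearMap.range (u - 1) : Submodule ℤ L) ⧸
        Submodule.comap (LinearMap.range (t - 1) ⊔ LinearMap.range (u - 1)).subtype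
          (LinearMap.range (t * u - 1))) =
      Nat.card (Submodule.map (Tel t).mkQ (LinearMap.range (u - 1))) := by
  have huu := involution_apply_apply hu
  set S : Submodule ℤ L := LinearMap.range (t - 1) ⊔ LinearMap.range (u - 1) with hS
  set N : Submodule ℤ S := Submodule.comap S.subtype (LinearMap.range (t * u - 1)) with hN
  let φ : L →ₗ[ℤ] S ⧸ N := N.mkQ ∘ₗ
    LinearMap.codRestrict S (t - 1) fun x => Submodule.mem_sup_left ⟨x, rfl⟩
  have hφ : Function.Surjective φ := by
    intro q
    obtain ⟨⟨s, hs⟩, rfl⟩ := N.mkQ_surjective q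
    obtain ⟨_, ⟨x, rfl⟩, _, ⟨y, rfl⟩, rfl⟩ := Submodule.mem_sup.mp hs
    refine ⟨x + y, (Submodule.Quotient.eq N).mpr ⟨u y, ?_⟩⟩
    simp [huu]
  let ψ : L →ₗ[ℤ] L ⧸ Tel t := (Tel t).mkQ ∘ₗ (u - 1)
  have hψ : Submodule.map (Tel t).mkQ (LinearMap.range (u - 1)) = LinearMap.range ψ :=
    (LinearMap.range_comp _ _).symm
  have hker : LinearMap.ker φ = LinearMap.ker ψ := by
    ext x
    have h1 : φ x = 0 ↔ t x - x ∈ LinearMap.range (t * u - 1) := Submodule.Quotient.mk_eq_zero N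
    have h2 : ψ x = 0 ↔ u x - x ∈ Tel t := Submodule.Quotient.mk_eq_zero (Tel t)
    rw [LinearMap.mem_ker, LinearMap.mem_ker, h1, h2]
    exact sub_mem_range_iff_sub_mem_Tel ht hu hz x
  rw [hψ]
  exact Nat.card_congr ((φ.quotKerEquivOfSurjective hφ).symm.trans
    ((Submodule.quotEquivOfEq _ _ hker).trans ψ.quotKerEquivRange)).toEquiv

theorem range_sub_one_le_Tel_iff (ht : t * t = 1) (hu : u * u = 1)
    (hz : (t * u) * (t * u) = -1) :
    LinearMap.range (u - 1) ≤ Tel t ↔ Tel t ⊔ eigP u = ⊤ := by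
  have huu := involution_apply_apply hu
  have htu (x : L) : t (u x) = -u (t x) := by rw [anticomm_apply ht hu hz, neg_neg]
  constructor
  · intro h
    refine eq_top_iff.mpr fun x _ => ?_
    obtain ⟨a, ha, b, hb, hab⟩ := Submodule.mem_sup.mp (h ⟨x, rfl⟩)
    have hx : a + b = u x - x := by simpa using hab
    have hat := mem_eigP.mp ha
    have hbt := mem_eigM.mp hb
    have h1 := congrArg u hx
    simp only [map_add, map_sub, huu] at h1
    have h3 : u a + b = 0 := by
      have h2 : a + b + (u a + u b) = 0 := by rw [hx, h1]; abel
      have h4 := congrArg t h2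
      simp only [map_add, map_zero, htu, hat, hbt, map_neg, neg_neg] at h4
      apply eq_zero_of_add_self
      rw [← sub_zero (0 : L)]
      nth_rewrite 1 [← h2]
      rw [← h4]
      abel
    have h5 : x + a ∈ eigP u := by
      rw [mem_eigP, map_add, eq_neg_of_add_eq_zero_left h3, ← sub_eq_zero]
      rw [← sub_eq_zero] at hx
      rw [← neg_eq_zero, ← hx]
      abel
    rw [← neg_add_cancel_left a x, add_comm a x]
    exact Submodule.add_mem_sup (neg_mem (Submodule.mem_sup_left ha)) h5
  · rintro h _ ⟨x, rfl⟩
    have hx : x ∈ Tel t ⊔ eigP u := h ▸ Submodule.mem_top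
    obtain ⟨c, hc, e, he, rfl⟩ := Submodule.mem_sup.mp hx
    have hstable : u c ∈ Tel t := by
      obtain ⟨a, ha, b, hb, rfl⟩ := Submodule.mem_sup.mp hc
      rw [mem_eigP] at ha
      rw [mem_eigM] at hb
      rw [map_add, add_comm]
      refine Submodule.add_mem_sup (mem_eigP.mpr ?_) (mem_eigM.mpr ?_)
      · rw [htu, hb, map_neg, neg_neg]
      · rw [htu, ha]
    have he' : (u - 1) (c + e) = u c - c := by
      simp [mem_eigP.mp he]
    rw [he']
    exact sub_mem hstable hc

end DihedralAction

/-- With `f = tu` of order 4 and `d` the number of size-2 Jordan blocks of `u` on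
`L/Tel(t)`: the index `|L(t-1)+L(u-1) : L(f-1)|` is `2^d`; commutator density
`L(f-1) = L(t-1)+L(u-1)` holds iff `d = 0`, iff `L = Tel(t) + L^+(u)`
(2/4-generation). -/
theorem comm_density_iff_two_fourths_generation {L : Type*} [AddCommGroup L]
    [Module.Free ℤ L] [Module.Finite ℤ L] (n d : ℕ)
    (hrank : Module.finrank ℤ L = 2 * n)
    (t u : Module.End ℤ L) (ht : t * t = 1) (hu : u * u = 1)
    (hz : (t * u) * (t * u) = -1)
    (hd : Nat.card (Submodule.map (Tel t).mkQ (LinearMap.range (u - 1))) = 2 ^ d) :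
    Nat.card ((LinearMap.range (t - 1) ⊔ LinearMap.range (u - 1) : Submodule ℤ L) ⧸
        Submodule.comap (LinearMap.range (t - 1) ⊔ LinearMap.range (u - 1)).subtype
          (LinearMap.range (t * u - 1))) = 2 ^ d ∧
      (LinearMap.range (t * u - 1)
          = LinearMap.range (t - 1) ⊔ LinearMap.range (u - 1) ↔ d = 0) ∧
      (d = 0 ↔ Tel t ⊔ eigP u = ⊤) := by
  have hcard := (card_commutator_quotient_eq ht hu hz).trans hd
  have hpow (k : ℕ) : 2 ^ k = 1 ↔ k = 0 := by simp
  refine ⟨hcard, ?_, ?_⟩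
  · rw [← hpow d, ← hcard, ← Submodule.cardQuot_apply, Submodule.cardQuot_eq_one_iff,
      Submodule.comap_subtype_eq_top]
    exact ⟨fun h => h.ge, range_mul_sub_one_le.antisymm⟩
  · rw [← hpow d, ← hd, ← range_sub_one_le_Tel_iff ht hu hz]
    have hbot : LinearMap.range (u - 1) ≤ Tel t ↔
        Submodule.map (Tel t).mkQ (LinearMap.range (u - 1)) = ⊥ := by
      rw [eq_bot_iff, Submodule.map_le_iff_le_comap, Submodule.comap_bot, Submodule.ker_mkQ]
    rw [hbot, ← Submodule.toAddSubgroup_inj, Submodule.bot_toAddSubgroup,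
      ← AddSubgroup.card_eq_one]
    rfl
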